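/- arXiv:2105.10079 — 3 statements merged into one kernel-verified Lean document; each statement's English description precedes it below -/
import Mathlib

section
/- Let ε ≥ 0, L ≥ 0 with L + εL < 1, and let ρ : ℝ² → ℝ be a positive Lipschitz continuous function with Lipschitz constant L (on the Euclidean plane). Let x, y, w be three affinely independent points in the Euclidean plane such that the segment xy is a shortest edge of the triangle xyw (i.e., dist(x,y) ≤ dist(x,w) and dist(x,y) ≤ dist(y,w)), and such that dist(x,y) ≥ min(ρ(x), ρ(y)). Let c be the circumcenter of the triangle xyw, and suppose there exists a point v with dist(c,v) ≤ (1+ε)·ρ(c) and dist(c,x) ≤ dist(c,v) (no point of the sampling lies strictly inside the circumcircle, and maximality provides v within coverage distance of c). Then every interior angle α of the triangle xyw satisfies α ≥ arcsin((1 − L − εL)/(2 + 2ε)), equivalently sin(α) ≥ (1 − L − εL)/(2 + 2ε). -/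
open EuclideanGeometry

theorem aux_sin {x y w c : EuclideanSpace ℝ (Fin 2)}
    (hind : AffineIndependent ℝ ![x, y, w])
    (hcx : dist c x = dist c y) (hcy : dist c y = dist c w) :
    0 < dist c x ∧ dist y w = 2 * dist c x * Real.sin (∠ y x w) ∧
    dist x w = 2 * dist c x * Real.sin (∠ x y w) ∧
    dist x y = 2 * dist c x * Real.sin (∠ x w y) := by
  let t : Affine.Triangle ℝ (EuclideanSpace ℝ (Fin 2)) := ⟨![x, y, w], hind⟩
  have htop : affineSpan ℝ (Set.range t.points) = ⊤ := by
    apply (AffineIndependent.affineSpan_eq_top_iff_card_eq_finrank_add_one t.independent).2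
    simp
  have hR : dist c x = t.circumradius := by
    apply t.eq_circumradius_of_dist_eq (p := c)
    · rw [htop]; trivial
    · intro i
      fin_cases i
      · exact dist_comm _ _
      · exact (dist_comm _ _).trans hcx.symm
      · exact (dist_comm _ _).trans (hcx.trans hcy).symm
  have hpos : 0 < dist c x := hR ▸ t.circumradius_pos
  have key : ∀ i j k : Fin 3, i ≠ j → i ≠ k → j ≠ k →
      dist (t.points i) (t.points k)
        = 2 * dist c x * Real.sin (∠ (t.points i) (t.points j) (t.points k)) := by
    intro i j k h1 h2 h3
    have h := t.dist_div_sin_angle_eq_two_mul_circumradius h1 h2 h3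
    rw [← hR] at h
    have hs : Real.sin (∠ (t.points i) (t.points j) (t.points k)) ≠ 0 := by
      intro h0
      rw [h0, div_zero] at h
      linarith
    rwa [div_eq_iff hs] at h
  exact ⟨hpos, key 1 0 2 (by decide) (by decide) (by decide),
    key 0 1 2 (by decide) (by decide) (by decide), key 0 2 1 (by decide) (by decide) (by decide)⟩

theorem aux_arcsin {p q r : EuclideanSpace ℝ (Fin 2)} {s : ℝ} (h : Real.sin (∠ p q r) ≥ s) :
    Real.sin (∠ p q r) ≥ s ∧ ∠ p q r ≥ Real.arcsin s := by
  refine ⟨h, ?_⟩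
  rcases le_total (∠ p q r) (Real.pi / 2) with h1 | h1
  · have h0 := angle_nonneg p q r
    calc Real.arcsin s ≤ Real.arcsin (Real.sin (∠ p q r)) := Real.monotone_arcsin h
      _ = ∠ p q r := Real.arcsin_sin (by linarith [Real.pi_pos]) h1
  · exact (Real.arcsin_le_pi_div_two s).trans h1

theorem stmt_3 (ε L : ℝ) (hε : 0 ≤ ε) (hL : 0 ≤ L) (hLε : L + ε * L < 1)
    (ρ : EuclideanSpace ℝ (Fin 2) → ℝ)
    (hpos : ∀ u, 0 < ρ u)
    (hlip : ∀ u v, |ρ u - ρ v| ≤ L * dist u v)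
    (x y w : EuclideanSpace ℝ (Fin 2))
    (hind : AffineIndependent ℝ ![x, y, w])
    (hshort₁ : dist x y ≤ dist x w) (hshort₂ : dist x y ≤ dist y w)
    (hdisk : dist x y ≥ min (ρ x) (ρ y))
    (c : EuclideanSpace ℝ (Fin 2))
    (hcx : dist c x = dist c y) (hcy : dist c y = dist c w)
    (v : EuclideanSpace ℝ (Fin 2))
    (hv : dist c v ≤ (1 + ε) * ρ c)
    (hvout : dist c x ≤ dist c v) :
    (Real.sin (∠ y x w) ≥ (1 - L - ε * L) / (2 + 2 * ε) ∧
        ∠ y x w ≥ Real.arcsin ((1 - L - ε * L) / (2 + 2 * ε))) ∧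
    (Real.sin (∠ x y w) ≥ (1 - L - ε * L) / (2 + 2 * ε) ∧
        ∠ x y w ≥ Real.arcsin ((1 - L - ε * L) / (2 + 2 * ε))) ∧
    (Real.sin (∠ x w y) ≥ (1 - L - ε * L) / (2 + 2 * ε) ∧
        ∠ x w y ≥ Real.arcsin ((1 - L - ε * L) / (2 + 2 * ε))) := by
  obtain ⟨hR, h1, h2, h3⟩ := aux_sin hind hcx hcy
  have hx := (abs_le.1 (hlip c x)).2
  have hy := (abs_le.1 (hlip c y)).2
  rw [← hcx] at hy
  have hmin : ρ c - L * dist c x ≤ dist x y :=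
    le_trans (le_min (by linarith) (by linarith)) hdisk
  have hd : dist c x * (1 - L - ε * L) ≤ (1 + ε) * dist x y := by
    have := mul_le_mul_of_nonneg_left hmin (by linarith : (0:ℝ) ≤ 1 + ε)
    nlinarith
  have key : ∀ s : ℝ, dist x y ≤ 2 * dist c x * s → s ≥ (1 - L - ε * L) / (2 + 2 * ε) := by
    intro s hs
    rw [ge_iff_le, div_le_iff₀ (by linarith)]
    have := mul_le_mul_of_nonneg_left hs (by linarith : (0:ℝ) ≤ 1 + ε)
    refine le_of_mul_le_mul_left ?_ hR
    linarith
  exact ⟨aux_arcsin (key _ (h1 ▸ hshort₂)), aux_arcsin (key _ (h2 ▸ hshort₁)),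
    aux_arcsin (key _ h3.le)⟩
end

section
/- Let c be a point of the Euclidean plane, R ≥ 0, and let b₁ ≠ b₂ be two points on the sphere (circle) of center c and radius R. Let x be a point of the closed ball of center c and radius R such that x and c do not lie strictly on the same side of the line through b₁ and b₂ (i.e., x is on the far side of, or on, the chord line relative to the center). Then dist(x, midpoint(b₁,b₂)) ≤ dist(b₁,b₂)/2; that is, the part of the disk cut off by a chord and not containing the center is contained in the disk whose diameter is that chord. -/
theorem stmt_4 (c : EuclideanSpace ℝ (Fin 2)) (R : ℝ) (hR : 0 ≤ R)
    (b₁ b₂ : EuclideanSpace ℝ (Fin 2)) (hne : b₁ ≠ b₂)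
    (hb₁ : b₁ ∈ Metric.sphere c R) (hb₂ : b₂ ∈ Metric.sphere c R)
    (x : EuclideanSpace ℝ (Fin 2)) (hx : x ∈ Metric.closedBall c R)
    (hside : ¬ (affineSpan ℝ {b₁, b₂}).SSameSide x c) :
    dist x (midpoint ℝ b₁ b₂) ≤ dist b₁ b₂ / 2 := by
  have hm : ∀ i, (midpoint ℝ b₁ b₂) i = (b₁ i + b₂ i) / 2 := by
    intro i
    rw [midpoint_eq_smul_add]
    simp
    ring
  have hD : ∀ p q : EuclideanSpace ℝ (Fin 2),
      dist p q ^ 2 = (p 0 - q 0) ^ 2 + (p 1 - q 1) ^ 2 := by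
    intro p q
    rw [EuclideanSpace.dist_eq, Real.sq_sqrt (by positivity)]
    simp [Fin.sum_univ_two, Real.dist_eq, sq_abs]
  have h1 := hD b₁ c
  have h2 := hD b₂ c
  have h3 := hD x c
  rw [Metric.mem_sphere] at hb₁ hb₂
  rw [Metric.mem_closedBall] at hx
  rw [hb₁] at h1
  rw [hb₂] at h2
  have h4 : dist x c ^ 2 ≤ R ^ 2 := pow_le_pow_left₀ dist_nonneg hx 2
  refine (sq_le_sq₀ dist_nonneg (by positivity)).1 ?_
  rw [div_pow, hD, hD, hm, hm]
  have hd : 0 < (b₂ 0 - b₁ 0) ^ 2 + (b₂ 1 - b₁ 1) ^ 2 := by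
    rw [← hD]
    have := dist_pos.2 hne.symm
    positivity
  have key : (c 0 - (b₁ 0 + b₂ 0) / 2) * (x 0 - (b₁ 0 + b₂ 0) / 2)
      + (c 1 - (b₁ 1 + b₂ 1) / 2) * (x 1 - (b₁ 1 + b₂ 1) / 2) ≤ 0 := by
    by_contra! hpos
    apply hside
    set N := (b₂ 0 - b₁ 0) ^ 2 + (b₂ 1 - b₁ 1) ^ 2 with hN
    have perp : (c 0 - (b₁ 0 + b₂ 0) / 2) * (b₂ 0 - b₁ 0)
      + (c 1 - (b₁ 1 + b₂ 1) / 2) * (b₂ 1 - b₁ 1) = 0 := by linarith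
    obtain ⟨l, hl⟩ : ∃ l, l = ((b₂ 0 - b₁ 0) * (c 1 - (b₁ 1 + b₂ 1) / 2)
      - (b₂ 1 - b₁ 1) * (c 0 - (b₁ 0 + b₂ 0) / 2)) / N := ⟨_, rfl⟩
    obtain ⟨k, hk⟩ : ∃ k, k = ((b₂ 0 - b₁ 0) * (x 1 - (b₁ 1 + b₂ 1) / 2)
      - (b₂ 1 - b₁ 1) * (x 0 - (b₁ 0 + b₂ 0) / 2)) / N := ⟨_, rfl⟩
    obtain ⟨s, hs⟩ : ∃ s, s = ((b₂ 0 - b₁ 0) * (x 0 - (b₁ 0 + b₂ 0) / 2)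
      + (b₂ 1 - b₁ 1) * (x 1 - (b₁ 1 + b₂ 1) / 2)) / N := ⟨_, rfl⟩
    rw [eq_div_iff hd.ne'] at hl hk hs
    have c0 : c 0 - (b₁ 0 + b₂ 0) / 2 = - l * (b₂ 1 - b₁ 1) := by
      apply mul_right_cancel₀ hd.ne'
      linear_combination (b₂ 1 - b₁ 1) * hl + (b₂ 0 - b₁ 0) * perp + (c 0 - (b₁ 0 + b₂ 0) / 2) * hN
    have c1 : c 1 - (b₁ 1 + b₂ 1) / 2 = l * (b₂ 0 - b₁ 0) := by
      apply mul_right_cancel₀ hd.ne'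
      linear_combination -(b₂ 0 - b₁ 0) * hl + (b₂ 1 - b₁ 1) * perp + (c 1 - (b₁ 1 + b₂ 1) / 2) * hN
    have x0 : x 0 - (b₁ 0 + b₂ 0) / 2 = s * (b₂ 0 - b₁ 0) - k * (b₂ 1 - b₁ 1) := by
      apply mul_right_cancel₀ hd.ne'
      linear_combination (b₂ 1 - b₁ 1) * hk - (b₂ 0 - b₁ 0) * hs + (x 0 - (b₁ 0 + b₂ 0) / 2) * hN
    have x1 : x 1 - (b₁ 1 + b₂ 1) / 2 = s * (b₂ 1 - b₁ 1) + k * (b₂ 0 - b₁ 0) := by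
      apply mul_right_cancel₀ hd.ne'
      linear_combination -(b₂ 0 - b₁ 0) * hk - (b₂ 1 - b₁ 1) * hs + (x 1 - (b₁ 1 + b₂ 1) / 2) * hN
    have hlk : 0 < l * k := by
      rw [c0, c1, x0, x1] at hpos
      have : 0 < (l * k) * N := by rw [hN]; linarith
      exact pos_of_mul_pos_left this hd.le
    have hl0 : l ≠ 0 := by rintro rfl; simp at hlk
    have ht : 0 < k / l := by
      have : k / l = l * k / l ^ 2 := by field_simp
      rw [this]; positivity
    have hc : c ∉ affineSpan ℝ {b₁, b₂} := by
      intro h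
      obtain ⟨r, hr⟩ := mem_affineSpan_pair_iff_exists_lineMap_eq.1 h
      have e0 : c 0 = r * (b₂ 0 - b₁ 0) + b₁ 0 := by
        rw [← hr]; simp [AffineMap.lineMap_apply]
      have e1 : c 1 = r * (b₂ 1 - b₁ 1) + b₁ 1 := by
        rw [← hr]; simp [AffineMap.lineMap_apply]
      have : l * N = 0 := by rw [hl, e0, e1]; ring
      exact (mul_ne_zero hl0 hd.ne') this
    have hxe : x = (k / l) • (c -ᵥ AffineMap.lineMap b₁ b₂ (1 / 2 : ℝ)) +ᵥ
        AffineMap.lineMap b₁ b₂ (1 / 2 + s) := by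
      ext i
      fin_cases i
      · simp [AffineMap.lineMap_apply]
        have : c 0 = (b₁ 0 + b₂ 0) / 2 - l * (b₂ 1 - b₁ 1) := by linarith
        rw [this]
        field_simp
        linear_combination 2 * l * x0
      · simp [AffineMap.lineMap_apply]
        have : c 1 = (b₁ 1 + b₂ 1) / 2 + l * (b₂ 0 - b₁ 0) := by linarith
        rw [this]
        field_simp
        linear_combination 2 * l * x1
    rw [hxe]
    exact AffineSubspace.sSameSide_smul_vsub_vadd_left hc
      (AffineMap.lineMap_mem_affineSpan_pair _ _ _) (AffineMap.lineMap_mem_affineSpan_pair _ _ _) ht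
  nlinarith
end

section
/- Let c be a point of the Euclidean plane, R ≥ 0, and let b₁ ≠ b₂ be two points on the sphere (circle) of center c and radius R. Let x be a point of the closed ball of center c and radius R such that x and c do not lie strictly on the same side of the line through b₁ and b₂. Then min(dist(x,b₁), dist(x,b₂)) ≤ dist(b₁,b₂)/√2; that is, every point of the disk lying beyond the chord is within distance |b₁b₂|/√2 of the nearer chord endpoint. -/
theorem stmt_6 (c : EuclideanSpace ℝ (Fin 2)) (R : ℝ) (hR : 0 ≤ R)
    (b₁ b₂ : EuclideanSpace ℝ (Fin 2)) (hne : b₁ ≠ b₂)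
    (hb₁ : b₁ ∈ Metric.sphere c R) (hb₂ : b₂ ∈ Metric.sphere c R)
    (x : EuclideanSpace ℝ (Fin 2)) (hx : x ∈ Metric.closedBall c R)
    (hside : ¬ (affineSpan ℝ {b₁, b₂}).SSameSide x c) :
    min (dist x b₁) (dist x b₂) ≤ dist b₁ b₂ / Real.sqrt 2 := by
  have key : ∀ p q : EuclideanSpace ℝ (Fin 2),
      dist p q ^ 2 = (p 0 - q 0) ^ 2 + (p 1 - q 1) ^ 2 := by
    intro p q
    rw [EuclideanSpace.dist_eq, Real.sq_sqrt (by positivity)]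
    simp [Real.dist_eq, sq_abs]
  have h1 : dist b₁ c ^ 2 = R ^ 2 := by rw [Metric.mem_sphere.1 hb₁]
  have h2 : dist b₂ c ^ 2 = R ^ 2 := by rw [Metric.mem_sphere.1 hb₂]
  have h3 : dist x c ^ 2 ≤ R ^ 2 := pow_le_pow_left₀ dist_nonneg (Metric.mem_closedBall.1 hx) 2
  rw [key] at h1 h2 h3
  have hD : 0 < (b₂ 0 - b₁ 0) ^ 2 + (b₂ 1 - b₁ 1) ^ 2 := by
    rw [← key]
    have := dist_pos.2 hne.symm
    positivity
  have hmem : ∀ p : EuclideanSpace ℝ (Fin 2), p ∈ affineSpan ℝ {b₁, b₂} ↔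
      ∃ r : ℝ, p 0 = b₁ 0 + r * (b₂ 0 - b₁ 0) ∧ p 1 = b₁ 1 + r * (b₂ 1 - b₁ 1) := by
    intro p
    rw [mem_affineSpan_pair_iff_exists_lineMap_eq]
    refine exists_congr fun r => ?_
    constructor
    · rintro rfl
      simp [AffineMap.lineMap_apply, add_comm]
    · rintro ⟨h, h'⟩
      ext i
      fin_cases i
      · simp [AffineMap.lineMap_apply, h, add_comm]
      · simp [AffineMap.lineMap_apply, h', add_comm]
  have hmain : 0 ≤ (x 0 - (b₁ 0 + b₂ 0) / 2) * ((b₁ 0 + b₂ 0) / 2 - c 0)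
      + (x 1 - (b₁ 1 + b₂ 1) / 2) * ((b₁ 1 + b₂ 1) / 2 - c 1) := by
    by_contra hneg
    push Not at hneg
    apply hside
    have hperp : (b₂ 0 - b₁ 0) * ((b₁ 0 + b₂ 0) / 2 - c 0)
      + (b₂ 1 - b₁ 1) * ((b₁ 1 + b₂ 1) / 2 - c 1) = 0 := by linarith
    set D := (b₂ 0 - b₁ 0) ^ 2 + (b₂ 1 - b₁ 1) ^ 2 with hDdef
    set m : EuclideanSpace ℝ (Fin 2) := !₂[(b₁ 0 + b₂ 0) / 2, (b₁ 1 + b₂ 1) / 2] with hm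
    have hm0 : m 0 = (b₁ 0 + b₂ 0) / 2 := by simp [hm]
    have hm1 : m 1 = (b₁ 1 + b₂ 1) / 2 := by simp [hm]
    have hmm : m ∈ affineSpan ℝ {b₁, b₂} :=
      (hmem m).2 ⟨1/2, by rw [hm0]; ring, by rw [hm1]; ring⟩
    rw [← hm0, ← hm1] at hneg hperp
    have hN : 0 < (c 0 - m 0) ^ 2 + (c 1 - m 1) ^ 2 := by
      by_contra hcon
      have e0 : m 0 - c 0 = 0 := by nlinarith [sq_nonneg (c 0 - m 0), sq_nonneg (c 1 - m 1)]
      have e1 : m 1 - c 1 = 0 := by nlinarith [sq_nonneg (c 0 - m 0), sq_nonneg (c 1 - m 1)]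
      rw [e0, e1] at hneg
      simp at hneg
    set N := (c 0 - m 0) ^ 2 + (c 1 - m 1) ^ 2 with hNdef
    have hc : c ∉ affineSpan ℝ {b₁, b₂} := by
      rw [hmem]
      rintro ⟨r, h0, h1⟩
      have e0 : c 0 - m 0 = (r - 1/2) * (b₂ 0 - b₁ 0) := by rw [h0, hm0]; ring
      have e1 : c 1 - m 1 = (r - 1/2) * (b₂ 1 - b₁ 1) := by rw [h1, hm1]; ring
      have : N = -(r - 1/2) * ((b₂ 0 - b₁ 0) * (m 0 - c 0) + (b₂ 1 - b₁ 1) * (m 1 - c 1)) := by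
        linear_combination (c 0 - m 0) * e0 + (c 1 - m 1) * e1
      rw [hperp] at this
      linarith
    obtain ⟨t, ht⟩ : ∃ t, t = ((x 0 - m 0) * (c 0 - m 0) + (x 1 - m 1) * (c 1 - m 1)) / N := ⟨_, rfl⟩
    have htN : t * N = (x 0 - m 0) * (c 0 - m 0) + (x 1 - m 1) * (c 1 - m 1) := by
      rw [ht]; field_simp
    have htpos : 0 < t := by rw [ht]; apply div_pos _ hN; linarith
    have hp : x - t • (c - m) ∈ affineSpan ℝ {b₁, b₂} := by
      obtain ⟨r, hr⟩ : ∃ r, r = ((x 0 - m 0) * (b₂ 0 - b₁ 0) + (x 1 - m 1) * (b₂ 1 - b₁ 1)) / D :=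
        ⟨_, rfl⟩
      have hrD : r * D = (x 0 - m 0) * (b₂ 0 - b₁ 0) + (x 1 - m 1) * (b₂ 1 - b₁ 1) := by
        rw [hr]; field_simp
      -- residual vector is orthogonal to both directions
      obtain ⟨u, hu⟩ : ∃ u, u = x 0 - m 0 - t * (c 0 - m 0) - r * (b₂ 0 - b₁ 0) := ⟨_, rfl⟩
      obtain ⟨v, hv⟩ : ∃ v, v = x 1 - m 1 - t * (c 1 - m 1) - r * (b₂ 1 - b₁ 1) := ⟨_, rfl⟩
      have o1 : u * (c 0 - m 0) + v * (c 1 - m 1) = 0 := by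
        rw [hu, hv]; linear_combination -htN + r * hperp
      have o2 : u * (b₂ 0 - b₁ 0) + v * (b₂ 1 - b₁ 1) = 0 := by
        rw [hu, hv]; linear_combination -hrD + t * hperp
      have hdet : ((c 0 - m 0) * (b₂ 1 - b₁ 1) - (c 1 - m 1) * (b₂ 0 - b₁ 0)) ^ 2 = N * D := by
        rw [hNdef, hDdef]
        linear_combination (-((b₂ 0 - b₁ 0) * (m 0 - c 0) + (b₂ 1 - b₁ 1) * (m 1 - c 1))) * hperp
      have hdet0 : (c 0 - m 0) * (b₂ 1 - b₁ 1) - (c 1 - m 1) * (b₂ 0 - b₁ 0) ≠ 0 := by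
        intro h
        rw [h] at hdet
        have := mul_pos hN hD
        linarith
      have u0 : u = 0 := by
        apply (mul_eq_zero.1 _).resolve_right hdet0
        linear_combination (b₂ 1 - b₁ 1) * o1 - (c 1 - m 1) * o2
      have v0 : v = 0 := by
        apply (mul_eq_zero.1 _).resolve_right hdet0
        linear_combination (c 0 - m 0) * o2 - (b₂ 0 - b₁ 0) * o1
      refine (hmem _).2 ⟨r + 1/2, ?_, ?_⟩
      · simp only [PiLp.sub_apply, PiLp.smul_apply, smul_eq_mul]
        linear_combination u0 - hu + hm0
      · simp only [PiLp.sub_apply, PiLp.smul_apply, smul_eq_mul]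
        linear_combination v0 - hv + hm1
    have := AffineSubspace.sSameSide_smul_vsub_vadd_left hc hmm hp htpos
    simpa using this
  have hsum : dist x b₁ ^ 2 + dist x b₂ ^ 2 ≤ dist b₁ b₂ ^ 2 := by
    rw [key, key, key]
    nlinarith
  rw [le_div_iff₀ (by positivity)]
  refine (pow_le_pow_iff_left₀ (by positivity) dist_nonneg two_ne_zero).1 ?_
  rw [mul_pow, Real.sq_sqrt (by norm_num)]
  have a1 := pow_le_pow_left₀ (le_min dist_nonneg dist_nonneg) (min_le_left (dist x b₁) (dist x b₂)) 2
  have a2 := pow_le_pow_left₀ (le_min dist_nonneg dist_nonneg) (min_le_right (dist x b₁) (dist x b₂)) 2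
  linarith
end
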